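/- arXiv:1912.00829 — 6 statements merged into one kernel-verified Lean document; each statement's English description precedes it below -/
import Mathlib

section
/- For all Δ, κ > 0, μ ∈ {0,1}, and all real u, x, y, the following exact factorization of the two-mode wavefunction after the q-syndrome-extraction beamsplitter and squeezer holds: φ^{Δ,κ}_μ(x + y/√2 − u) · φ^{Δ,κ}_ℤ(−x + y/√2) = Σ_{β ∈ {−1/2, 0, 1/2, 1}} φ^{Δ/√2, √2·κ}_{μ/2 − β}(y/√2 − u/2) · φ^{Δ/√2, √2·κ}_{μ/2 + β}(x − u/2). (All sums converge absolutely since every term is positive and Gaussian-dominated.) -/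
open Real

/-- Unnormalized approximate GKP comb wavefunction with widths `Δ, κ` and peak offset `ν`:
`φ^{Δ,κ}_ν(x) = Σ_{s∈ℤ} exp(−π κ² (2s+ν)²/2) · exp(−(x−(2s+ν)√π)²/(2Δ²))`. -/
noncomputable def gkp (Δ κ ν : ℝ) (x : ℝ) : ℝ :=
  ∑' s : ℤ, Real.exp (-(Real.pi * κ ^ 2 * (2 * (s : ℝ) + ν) ^ 2 / 2)) *
    Real.exp (-((x - (2 * (s : ℝ) + ν) * Real.sqrt Real.pi) ^ 2 / (2 * Δ ^ 2)))

/-- Full unnormalized GKP comb over all integer peaks: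
`φ^{Δ,κ}_ℤ(x) = Σ_{m∈ℤ} exp(−π κ² m²/2) · exp(−(x−m√π)²/(2Δ²))`. -/
noncomputable def gkpFull (Δ κ : ℝ) (x : ℝ) : ℝ :=
  ∑' m : ℤ, Real.exp (-(Real.pi * κ ^ 2 * (m : ℝ) ^ 2 / 2)) *
    Real.exp (-((x - (m : ℝ) * Real.sqrt Real.pi) ^ 2 / (2 * Δ ^ 2)))

theorem summable_gkp_term {κ : ℝ} (hκ : 0 < κ) (Δ ν x : ℝ) :
    Summable fun s : ℤ => Real.exp (-(Real.pi * κ ^ 2 * (2 * (s : ℝ) + ν) ^ 2 / 2)) *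
      Real.exp (-((x - (2 * (s : ℝ) + ν) * Real.sqrt Real.pi) ^ 2 / (2 * Δ ^ 2))) := by
  have h := (HurwitzZeta.hasSum_int_evenKernel (ν / 2) (t := 2 * κ ^ 2) (by positivity)).summable
  refine h.of_nonneg_of_le (fun s => by positivity) fun s => ?_
  refine (mul_le_of_le_one_right (Real.exp_pos _).le (Real.exp_le_one_iff.2 ?_)).trans_eq ?_
  · exact neg_nonpos.2 (by positivity)
  · congr 1
    ring

theorem summable_gkpFull_term {κ : ℝ} (hκ : 0 < κ) (Δ x : ℝ) :
    Summable fun m : ℤ => Real.exp (-(Real.pi * κ ^ 2 * (m : ℝ) ^ 2 / 2)) *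
      Real.exp (-((x - (m : ℝ) * Real.sqrt Real.pi) ^ 2 / (2 * Δ ^ 2))) := by
  have h := (HurwitzZeta.hasSum_int_evenKernel 0 (t := κ ^ 2 / 2) (by positivity)).summable
  refine h.of_nonneg_of_le (fun m => by positivity) fun m => ?_
  refine (mul_le_of_le_one_right (Real.exp_pos _).le (Real.exp_le_one_iff.2 ?_)).trans_eq ?_
  · exact neg_nonpos.2 (by positivity)
  · congr 1
    ring

/-- Decomposition of `ℤ × ℤ` into four cosets of the lattice spanned by `(1, 2)` and `(1, -2)`. -/
noncomputable def intProdCosetEquiv : Fin 4 × ℤ × ℤ ≃ ℤ × ℤ :=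
  Equiv.ofBijective
    (fun p => (p.2.1 + p.2.2, 2 * (p.2.1 - p.2.2) - ((p.1 : ℕ) : ℤ) + 1)) <| by
    constructor
    · rintro ⟨b, k, l⟩ ⟨b', k', l'⟩ h
      simp only [Prod.mk.injEq] at h ⊢
      obtain ⟨h₁, h₂⟩ := h
      have := b.isLt
      have := b'.isLt
      refine ⟨Fin.ext ?_, ?_, ?_⟩ <;> omega
    · rintro ⟨s, m⟩
      have hr : ((2 * s - m + 1) % 4).toNat < 4 := by omega
      refine ⟨(⟨((2 * s - m + 1) % 4).toNat, hr⟩,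
        (2 * s + m - 1 + (2 * s - m + 1) % 4) / 4,
        s - (2 * s + m - 1 + (2 * s - m + 1) % 4) / 4), ?_⟩
      simp only [Prod.mk.injEq]
      constructor <;> omega

theorem intProdCosetEquiv_apply (p : Fin 4 × ℤ × ℤ) :
    intProdCosetEquiv p = (p.2.1 + p.2.2, 2 * (p.2.1 - p.2.2) - ((p.1 : ℕ) : ℤ) + 1) :=
  rfl

/-- Rotation of a pair of Gaussian-weighted peaks by the balanced beamsplitter. -/
theorem gkp_term_mul_rotate (Δ κ a m c d X Y p q : ℝ)
    (ha : a = c + d) (hm : m = c - d) (hX : X = p + q) (hY : Y = p - q) :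
    (Real.exp (-(Real.pi * κ ^ 2 * a ^ 2 / 2)) *
        Real.exp (-((X - a * Real.sqrt Real.pi) ^ 2 / (2 * Δ ^ 2)))) *
      (Real.exp (-(Real.pi * κ ^ 2 * m ^ 2 / 2)) *
        Real.exp (-((Y - m * Real.sqrt Real.pi) ^ 2 / (2 * Δ ^ 2)))) =
    (Real.exp (-(Real.pi * (Real.sqrt 2 * κ) ^ 2 * c ^ 2 / 2)) *
        Real.exp (-((p - c * Real.sqrt Real.pi) ^ 2 / (2 * (Δ / Real.sqrt 2) ^ 2)))) *
      (Real.exp (-(Real.pi * (Real.sqrt 2 * κ) ^ 2 * d ^ 2 / 2)) *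
        Real.exp (-((q - d * Real.sqrt Real.pi) ^ 2 / (2 * (Δ / Real.sqrt 2) ^ 2)))) := by
  have h2 : Real.sqrt 2 ^ 2 = 2 := Real.sq_sqrt (by norm_num)
  have hD : 2 * (Δ / Real.sqrt 2) ^ 2 = Δ ^ 2 := by
    rw [div_pow, h2]
    ring
  rw [hD, mul_pow, h2]
  subst ha hm hX hY
  simp only [← Real.exp_add]
  congr 1
  ring

/-- Exact factorization of the two-mode wavefunction after the q-syndrome-extraction
beamsplitter and squeezer (core of Theorem 1, Glancy–Knill). -/
theorem qSE_factorization (Δ κ : ℝ) (hΔ : 0 < Δ) (hκ : 0 < κ)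
    (μ : ℝ) (hμ : μ = 0 ∨ μ = 1) (u x y : ℝ) :
    gkp Δ κ μ (x + y / Real.sqrt 2 - u) * gkpFull Δ κ (-x + y / Real.sqrt 2) =
      ∑ β ∈ ({-1/2, 0, 1/2, 1} : Finset ℝ),
        gkp (Δ / Real.sqrt 2) (Real.sqrt 2 * κ) (μ / 2 - β) (y / Real.sqrt 2 - u / 2) *
          gkp (Δ / Real.sqrt 2) (Real.sqrt 2 * κ) (μ / 2 + β) (x - u / 2) := by
  have hκ' : 0 < Real.sqrt 2 * κ := by positivity
  have hF := (summable_gkp_term hκ Δ μ (x + y / Real.sqrt 2 - u)).mul_of_nonneg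
    (summable_gkpFull_term hκ Δ (-x + y / Real.sqrt 2))
    (fun s => by positivity) (fun m => by positivity)
  have hL := (summable_gkp_term hκ Δ μ (x + y / Real.sqrt 2 - u)).tsum_mul_tsum
    (summable_gkpFull_term hκ Δ (-x + y / Real.sqrt 2)) hF
  have hfib : ∀ b : Fin 4, ∀ β : ℝ, 2 * β = ((b : ℕ) : ℝ) - 1 →
      ∑' p : ℤ × ℤ, (fun z : ℤ × ℤ =>
        (Real.exp (-(Real.pi * κ ^ 2 * (2 * (z.1 : ℝ) + μ) ^ 2 / 2)) *
          Real.exp (-((x + y / Real.sqrt 2 - u - (2 * (z.1 : ℝ) + μ) * Real.sqrt Real.pi) ^ 2 /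
            (2 * Δ ^ 2)))) *
        (Real.exp (-(Real.pi * κ ^ 2 * (z.2 : ℝ) ^ 2 / 2)) *
          Real.exp (-((-x + y / Real.sqrt 2 - (z.2 : ℝ) * Real.sqrt Real.pi) ^ 2 /
            (2 * Δ ^ 2))))) (intProdCosetEquiv (b, p)) =
        gkp (Δ / Real.sqrt 2) (Real.sqrt 2 * κ) (μ / 2 - β) (y / Real.sqrt 2 - u / 2) *
          gkp (Δ / Real.sqrt 2) (Real.sqrt 2 * κ) (μ / 2 + β) (x - u / 2) := by
    intro b β hβ
    have hp := summable_gkp_term hκ' (Δ / Real.sqrt 2) (μ / 2 - β) (y / Real.sqrt 2 - u / 2)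
    have hq := summable_gkp_term hκ' (Δ / Real.sqrt 2) (μ / 2 + β) (x - u / 2)
    have hpq := hp.mul_of_nonneg hq (fun s => by positivity) (fun m => by positivity)
    refine Eq.trans (tsum_congr fun p => ?_) (hp.tsum_mul_tsum hq hpq).symm
    refine gkp_term_mul_rotate Δ κ (2 * ((intProdCosetEquiv (b, p)).1 : ℝ) + μ)
      ((intProdCosetEquiv (b, p)).2 : ℝ) _ _ (x + y / Real.sqrt 2 - u)
      (-x + y / Real.sqrt 2) _ _ ?_ ?_ ?_ ?_
    · simp only [intProdCosetEquiv_apply]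
      push_cast
      ring
    · simp only [intProdCosetEquiv_apply]
      push_cast
      linarith
    · ring
    · ring
  refine (hL.trans (intProdCosetEquiv.tsum_eq _).symm).trans
    (((intProdCosetEquiv.summable_iff).2 hF).tsum_prod.trans ?_)
  rw [tsum_fintype, Fin.sum_univ_four, Finset.sum_insert (by norm_num),
    Finset.sum_insert (by norm_num), Finset.sum_insert (by norm_num), Finset.sum_singleton,
    ← add_assoc, ← add_assoc]
  refine congrArg₂ _ (congrArg₂ _ (congrArg₂ _ ?_ ?_) ?_) ?_
  · exact hfib 0 _ (by norm_num)
  · exact hfib 1 _ (by norm_num)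
  · exact hfib 2 _ (by norm_num)
  · exact hfib 3 _ (by norm_num)
end

section
/- For all Δ, κ > 0 and all z ∈ ℝ: Σ_{β ∈ {0,1}} [φ^{Δ/√2, √2·κ}_β(z)]² = c(Δ,κ) · φ^{Δ,κ}_0(2z), where c(Δ,κ) = Σ_{m∈ℤ} exp(−2π m² (κ² + 1/Δ²)). -/
open Real

/-- The z-independent proportionality constant . -/
noncomputable def gkpConst (Δ κ : ℝ) : ℝ :=
  ∑' m : ℤ, Real.exp (-(2 * Real.pi * (m : ℝ) ^ 2 * (κ ^ 2 + 1 / Δ ^ 2)))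

lemma summable_int_exp_neg_mul_sq {a : ℝ} (ha : 0 < a) :
    Summable fun n : ℤ ↦ Real.exp (-(a * (n : ℝ) ^ 2)) := by
  have h := summable_pow_mul_jacobiTheta₂_term_bound 0 (div_pos ha Real.pi_pos) 0
  refine h.congr fun n ↦ ?_
  rw [pow_zero, one_mul]
  congr 1
  field_simp
  ring

lemma summable_int_exp_neg_mul_sq_mul_exp {a b : ℝ} (ha : 0 < a) (hb : 0 ≤ b) (x y : ℝ) :
    Summable fun n : ℤ ↦
      Real.exp (-(a * (n : ℝ) ^ 2)) * Real.exp (-((x - n * y) ^ 2 * b)) :=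
  (summable_int_exp_neg_mul_sq ha).of_nonneg_of_le (fun n ↦ by positivity) fun n ↦
    mul_le_of_le_one_right (Real.exp_nonneg _) <| Real.exp_le_one_iff.2 <|
      neg_nonpos.2 (by positivity)

/-- Two integers of equal parity, given as `(2s, 2t)` or `(2s + 1, 2t + 1)`, are determined by
their half-difference and half-sum. -/
def sameParityPairMap : (ℤ × ℤ) ⊕ (ℤ × ℤ) → ℤ × ℤ :=
  Sum.elim (fun x ↦ (x.1 - x.2, x.1 + x.2)) (fun x ↦ (x.1 - x.2, x.1 + x.2 + 1))

lemma sameParityPairMap_bijective : Function.Bijective sameParityPairMap := by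
  constructor
  · rintro (⟨s, t⟩ | ⟨s, t⟩) (⟨s', t'⟩ | ⟨s', t'⟩) h <;>
      simp only [sameParityPairMap, Sum.elim_inl, Sum.elim_inr, Prod.mk.injEq] at h
    · obtain ⟨rfl, rfl⟩ : s = s' ∧ t = t' := by omega
      rfl
    · omega
    · omega
    · obtain ⟨rfl, rfl⟩ : s = s' ∧ t = t' := by omega
      rfl
  · rintro ⟨m, p⟩
    rcases Int.even_or_odd (m + p) with ⟨k, hk⟩ | ⟨k, hk⟩
    · refine ⟨Sum.inl (k, k - m), ?_⟩
      simp only [sameParityPairMap, Sum.elim_inl, Prod.mk.injEq]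
      omega
    · refine ⟨Sum.inr (k, k - m), ?_⟩
      simp only [sameParityPairMap, Sum.elim_inr, Prod.mk.injEq]
      omega

/-- If `F (p + m) * F (p - m) = c m * g p` for all integers `m`, `p`, then the squared sums of `F`
over the even and the odd integers add up to the product of the sums of `c` and `g`. -/
lemma tsum_even_sq_add_tsum_odd_sq {F c g : ℤ → ℝ} (hF : Summable F) (hc : Summable c)
    (hg : Summable g) (h : ∀ m p, F (p + m) * F (p - m) = c m * g p) :
    (∑' s, F (2 * s)) ^ 2 + (∑' s, F (2 * s + 1)) ^ 2 = (∑' m, c m) * ∑' p, g p := by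
  have h0 : Summable fun s ↦ F (2 * s) :=
    hF.comp_injective fun a b (hab : 2 * a = 2 * b) ↦ by omega
  have h1 : Summable fun s ↦ F (2 * s + 1) :=
    hF.comp_injective fun a b (hab : 2 * a + 1 = 2 * b + 1) ↦ by omega
  have k0 : ∀ x : ℤ × ℤ, F (2 * x.1) * F (2 * x.2) =
      c (sameParityPairMap (Sum.inl x)).1 * g (sameParityPairMap (Sum.inl x)).2 := fun x ↦ by
    rw [← h]
    congr 2 <;> simp only [sameParityPairMap, Sum.elim_inl] <;> ring
  have k1 : ∀ x : ℤ × ℤ, F (2 * x.1 + 1) * F (2 * x.2 + 1) =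
      c (sameParityPairMap (Sum.inr x)).1 * g (sameParityPairMap (Sum.inr x)).2 := fun x ↦ by
    rw [← h]
    congr 2 <;> simp only [sameParityPairMap, Sum.elim_inr] <;> ring
  rw [sq, sq, tsum_mul_tsum_of_summable_norm h0.norm h0.norm,
    tsum_mul_tsum_of_summable_norm h1.norm h1.norm,
    tsum_mul_tsum_of_summable_norm hc.norm hg.norm,
    ← (Equiv.ofBijective _ sameParityPairMap_bijective).tsum_eq (fun z ↦ c z.1 * g z.2)]
  simp only [Equiv.ofBijective_apply]
  rw [Summable.tsum_sum]
  · simp only [k0, k1]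
  · exact (summable_mul_of_summable_norm h0.norm h0.norm).congr k0
  · exact (summable_mul_of_summable_norm h1.norm h1.norm).congr k1

/-- Exact re-indexing identity (even-peak part) underlying the likelihood calculation
of Theorem 2: . -/
theorem gkp_reindex_even (Δ κ : ℝ) (hΔ : 0 < Δ) (hκ : 0 < κ) (z : ℝ) :
    ∑ β ∈ ({0, 1} : Finset ℝ), (gkp (Δ / Real.sqrt 2) (Real.sqrt 2 * κ) β z) ^ 2 =
      gkpConst Δ κ * gkp Δ κ 0 (2 * z) := by
  have h2 : Real.sqrt 2 ^ 2 = 2 := Real.sq_sqrt zero_le_two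
  have hpi : Real.sqrt Real.pi ^ 2 = Real.pi := Real.sq_sqrt Real.pi_nonneg
  have hF := summable_int_exp_neg_mul_sq_mul_exp (a := Real.pi * κ ^ 2) (b := 1 / Δ ^ 2)
    (by positivity) (by positivity) z (Real.sqrt Real.pi)
  have hc := summable_int_exp_neg_mul_sq (a := 2 * Real.pi * (κ ^ 2 + 1 / Δ ^ 2)) (by positivity)
  have hg := summable_int_exp_neg_mul_sq_mul_exp (a := 2 * Real.pi * κ ^ 2) (b := 2 / Δ ^ 2)
    (by positivity) (by positivity) z (Real.sqrt Real.pi)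
  have key := tsum_even_sq_add_tsum_odd_sq hF hc hg fun m p ↦ by
    simp only [← Real.exp_add]
    congr 1
    push_cast
    linear_combination (-2 * (m : ℝ) ^ 2 / Δ ^ 2) * hpi
  rw [Finset.sum_pair zero_ne_one, gkpConst]
  simp only [gkp]
  convert key using 3
  · refine tsum_congr fun s ↦ ?_
    push_cast
    rw [mul_pow, div_pow, h2]
    congr 2 <;> field_simp <;> ring
  · refine tsum_congr fun s ↦ ?_
    push_cast
    rw [mul_pow, div_pow, h2]
    congr 2 <;> field_simp
  · ext m
    congr 1
    ring
  · ext p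
    congr 2 <;> field_simp <;> ring
end

section
/- For all Δ, κ > 0 and all real x_m, u: Σ_{β ∈ {−1/2, 0, 1/2, 1}} [φ^{Δ/√2, √2·κ}_β(x_m/√2 − u/2)]² = c(Δ,κ) · (φ^{Δ,κ}_0 + φ^{Δ,κ}_1)(√2·x_m − u), where c(Δ,κ) = Σ_{m∈ℤ} exp(−2π m² (κ² + 1/Δ²)). In particular, the probability density of obtaining q-quadrature measurement outcome x_m given error shift u, P(x_m | u), is proportional to the GKP '+' wavefunction evaluated at √2·x_m − u, with proportionality constant independent of both x_m and u. -/
open Real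

/-- A double series over `ℤ × ℤ` splits into two series in the coordinates `(s - t, s + t)`,
according to whether the two summation indices have equal parity. -/
lemma hasSum_sub_add_of_hasSum {H : ℤ × ℤ → ℝ} {A B : ℝ}
    (hA : HasSum (fun p : ℤ × ℤ => H (p.1 - p.2, p.1 + p.2)) A)
    (hB : HasSum (fun p : ℤ × ℤ => H (p.1 - p.2, p.1 + p.2 + 1)) B) : HasSum H (A + B) := by
  have hf : Function.Injective (fun p : ℤ × ℤ => (p.1 - p.2, p.1 + p.2)) := by
    rintro ⟨a, b⟩ ⟨c, d⟩ h
    simp only [Prod.mk.injEq] at h ⊢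
    omega
  have hg : Function.Injective (fun p : ℤ × ℤ => (p.1 - p.2, p.1 + p.2 + 1)) := by
    rintro ⟨a, b⟩ ⟨c, d⟩ h
    simp only [Prod.mk.injEq] at h ⊢
    omega
  refine (hf.hasSum_range_iff.2 hA).add_isCompl ?_ (hg.hasSum_range_iff.2 hB)
  constructor
  · rw [Set.disjoint_left]
    rintro _ ⟨⟨a, b⟩, rfl⟩ ⟨⟨c, d⟩, h⟩
    simp only [Prod.mk.injEq] at h
    omega
  · rw [codisjoint_iff_compl_le_right]
    rintro ⟨m, k⟩ h
    simp only [Set.mem_compl_iff, Set.mem_range, Prod.exists, Prod.mk.injEq, not_exists,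
      not_and] at h
    refine ⟨((m + k - 1) / 2, (k - 1 - m) / 2), ?_⟩
    have := h ((m + k) / 2) ((k - m) / 2)
    simp only [Prod.mk.injEq]
    omega

/-- The summand of `gkp`, as a function of the real peak label. -/
noncomputable def gkpPeak (Δ κ x p : ℝ) : ℝ :=
  exp (-(π * κ ^ 2 * p ^ 2 / 2)) * exp (-((x - p * √π) ^ 2 / (2 * Δ ^ 2)))

lemma gkpPeak_nonneg (Δ κ x p : ℝ) : 0 ≤ gkpPeak Δ κ x p := by
  unfold gkpPeak
  positivity

lemma summable_gkpPeak (Δ : ℝ) {κ : ℝ} (hκ : 0 < κ) (ν x : ℝ) :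
    Summable fun s : ℤ => gkpPeak Δ κ x (2 * s + ν) := by
  refine Summable.of_nonneg_of_le (fun s => gkpPeak_nonneg _ _ _ _) (fun s => ?_)
    (HurwitzZeta.hasSum_int_evenKernel (ν / 2) (t := 2 * κ ^ 2) (by positivity)).summable
  calc gkpPeak Δ κ x (2 * s + ν)
      ≤ exp (-(π * κ ^ 2 * (2 * s + ν) ^ 2 / 2)) :=
        mul_le_of_le_one_right (exp_nonneg _)
          (exp_le_one_iff.2 (neg_nonpos.2 (by positivity)))
    _ = exp (-π * (s + ν / 2) ^ 2 * (2 * κ ^ 2)) := by ring_nf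

lemma hasSum_gkp (Δ : ℝ) {κ : ℝ} (hκ : 0 < κ) (ν x : ℝ) :
    HasSum (fun s : ℤ => gkpPeak Δ κ x (2 * s + ν)) (gkp Δ κ ν x) :=
  (summable_gkpPeak Δ hκ ν x).hasSum

lemma hasSum_gkpConst (Δ : ℝ) {κ : ℝ} (hκ : 0 < κ) :
    HasSum (fun m : ℤ => exp (-(2 * π * (m : ℝ) ^ 2 * (κ ^ 2 + 1 / Δ ^ 2)))) (gkpConst Δ κ) := by
  refine Summable.hasSum ?_
  convert (HurwitzZeta.hasSum_int_evenKernel 0 (t := 2 * (κ ^ 2 + 1 / Δ ^ 2))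
    (by positivity)).summable using 3
  ring

/-- Shifting the offset by a full period does not change the comb. -/
lemma gkp_sub_two (Δ κ ν x : ℝ) : gkp Δ κ (ν - 2) x = gkp Δ κ ν x := by
  unfold gkp
  rw [← (Equiv.addRight (1 : ℤ)).tsum_eq]
  refine tsum_congr fun s => ?_
  have h : 2 * (((s + 1 : ℤ) : ℝ)) + (ν - 2) = 2 * s + ν := by push_cast; ring
  simp only [Equiv.coe_addRight, h]

lemma hasSum_mul_of_nonneg {ι ι' : Type*} {f : ι → ℝ} {g : ι' → ℝ} {a b : ℝ}
    (hf : HasSum f a) (hg : HasSum g b) (hf0 : 0 ≤ f) (hg0 : 0 ≤ g) :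
    HasSum (fun p : ι × ι' => f p.1 * g p.2) (a * b) :=
  hf.mul hg (hf.summable.mul_of_nonneg hg.summable hf0 hg0)

/-- Completing the square in the product of two narrowed peaks. -/
lemma gkpPeak_mul_gkpPeak {Δ : ℝ} (hΔ : 0 < Δ) (κ x a b : ℝ) :
    gkpPeak (Δ / √2) (√2 * κ) x a * gkpPeak (Δ / √2) (√2 * κ) x b =
      exp (-(2 * π * ((a - b) / 2) ^ 2 * (κ ^ 2 + 1 / Δ ^ 2))) *
        gkpPeak Δ κ (2 * x) (a + b) := by
  unfold gkpPeak
  simp only [← exp_add, mul_pow, div_pow, sq_sqrt (zero_le_two : (0 : ℝ) ≤ 2)]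
  congr 1
  have hπ : √π ^ 2 = π := sq_sqrt pi_pos.le
  generalize √π = r at hπ
  rw [← hπ]
  field_simp
  ring

lemma hasSum_gkp_sq {Δ κ : ℝ} (hΔ : 0 < Δ) (hκ : 0 < κ) (β x : ℝ) :
    HasSum (fun p : ℤ × ℤ =>
      exp (-(2 * π * ((p.1 - p.2 : ℤ) : ℝ) ^ 2 * (κ ^ 2 + 1 / Δ ^ 2))) *
        gkpPeak Δ κ (2 * x) (2 * ((p.1 + p.2 : ℤ) : ℝ) + 2 * β))
      (gkp (Δ / √2) (√2 * κ) β x ^ 2) := by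
  have h := hasSum_gkp (Δ / √2) (κ := √2 * κ) (by positivity) β x
  rw [sq (gkp _ _ _ _)]
  convert hasSum_mul_of_nonneg h h (fun _ => gkpPeak_nonneg _ _ _ _)
    (fun _ => gkpPeak_nonneg _ _ _ _) using 2 with p
  rw [gkpPeak_mul_gkpPeak hΔ]
  push_cast
  congr 2 <;> ring

/-- Two combs with offsets differing by half a period have squares summing to a single
broader comb. -/
lemma gkp_sq_add_gkp_sq {Δ κ : ℝ} (hΔ : 0 < Δ) (hκ : 0 < κ) (β x : ℝ) :
    gkp (Δ / √2) (√2 * κ) β x ^ 2 + gkp (Δ / √2) (√2 * κ) (β + 1) x ^ 2 =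
      gkpConst Δ κ * gkp Δ κ (2 * β) (2 * x) := by
  refine HasSum.unique (hasSum_sub_add_of_hasSum
    (H := fun p => exp (-(2 * π * (p.1 : ℝ) ^ 2 * (κ ^ 2 + 1 / Δ ^ 2))) *
      gkpPeak Δ κ (2 * x) (2 * (p.2 : ℝ) + 2 * β)) (hasSum_gkp_sq hΔ hκ β x) ?_)
    (hasSum_mul_of_nonneg (hasSum_gkpConst Δ hκ) (hasSum_gkp Δ hκ (2 * β) (2 * x))
      (fun _ => exp_nonneg _) (fun _ => gkpPeak_nonneg _ _ _ _))
  convert hasSum_gkp_sq hΔ hκ (β + 1) x using 4 with p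
  push_cast
  ring

/-- Theorem 2 of the paper: the probability density of q-syndrome outcome `x_m` given
error shift `u` is proportional to the GKP '+' wavefunction at `√2·x_m − u`, with
proportionality constant `c(Δ,κ)` independent of both `x_m` and `u`. -/
theorem qSE_measurement_probability (Δ κ : ℝ) (hΔ : 0 < Δ) (hκ : 0 < κ) (xm u : ℝ) :
    ∑ β ∈ ({-1/2, 0, 1/2, 1} : Finset ℝ),
        (gkp (Δ / Real.sqrt 2) (Real.sqrt 2 * κ) β (xm / Real.sqrt 2 - u / 2)) ^ 2 =
      gkpConst Δ κ *
        (gkp Δ κ 0 (Real.sqrt 2 * xm - u) + gkp Δ κ 1 (Real.sqrt 2 * xm - u)) := by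
  have hx : 2 * (xm / √2 - u / 2) = √2 * xm - u := by
    have h2 : √2 ^ 2 = 2 := sq_sqrt zero_le_two
    field_simp
    linear_combination (-xm) * h2
  have heven := gkp_sq_add_gkp_sq hΔ hκ 0 (xm / √2 - u / 2)
  have hodd := gkp_sq_add_gkp_sq hΔ hκ (-1 / 2) (xm / √2 - u / 2)
  have hper := gkp_sub_two Δ κ 1 (√2 * xm - u)
  rw [hx] at heven hodd
  rw [show (1 : ℝ) - 2 = 2 * (-1 / 2) by norm_num] at hper
  rw [hper, show (-1 / 2 : ℝ) + 1 = 1 / 2 by norm_num] at hodd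
  rw [mul_zero, zero_add] at heven
  rw [Finset.sum_insert (by norm_num), Finset.sum_insert (by norm_num),
    Finset.sum_insert (by norm_num), Finset.sum_singleton, mul_add, ← heven, ← hodd]
  ring
end

section
/- Fix h ≥ 1, σ₀ > 0, a function f : ℝ → ℝ with |f(y)| ≤ √π for all y, and a real sequence (x_k). Let μ be the product measure on ℝ^h whose factors are each the Gaussian measure N(0, σ₀²), and for u ∈ ℝ^h let θ_h(u) = Σ_{k=1}^{h} 2^{k−h} (u_k/2 − f(X_k)) be the total shift after h rounds (with X_k the effective measurements built from (x_k) and f). Then ∫ |θ_h(u)| dμ(u) ≤ 2√π (1 − 2^{−h}) + σ₀ √(2(1 − 4^{−h})/(3π)). -/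
open Real MeasureTheory ProbabilityTheory

/-- The mean absolute value of a centered Gaussian of variance `v` is `√(2v/π)`. -/
theorem integral_abs_gaussianReal_zero (v : NNReal) :
    ∫ x, |x| ∂gaussianReal 0 v = √(2 * v / π) := by
  rcases eq_or_ne v 0 with rfl | hv
  · simp
  have hv' : (0 : ℝ) < v := by positivity
  have half_line : ∫ x in Set.Ioi (0 : ℝ), x * rexp (-x ^ 2 / (2 * v)) = v := by
    have gamma := integral_rpow_mul_exp_neg_mul_rpow (p := 2) (q := 1) (b := 1 / (2 * (v : ℝ)))
      (by norm_num) (by norm_num) (by positivity)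
    norm_num [rpow_neg_one] at gamma
    calc ∫ x in Set.Ioi (0 : ℝ), x * rexp (-x ^ 2 / (2 * v))
        = ∫ x in Set.Ioi (0 : ℝ), x * rexp (-((v : ℝ)⁻¹ * (1 / 2) * x ^ 2)) := by
          congr with x
          congr 2
          field_simp
      _ = v := by
          rw [gamma]
          ring
  rw [integral_gaussianReal_eq_integral_smul hv]
  calc ∫ x, gaussianPDFReal 0 v x • |x|
      = ∫ x, (√(2 * π * v))⁻¹ * (|x| * rexp (-|x| ^ 2 / (2 * v))) := by
        congr with x
        simp only [gaussianPDFReal, smul_eq_mul, sub_zero, sq_abs]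
        ring
    _ = (√(2 * π * v))⁻¹ * (2 * v) := by
        rw [integral_const_mul, integral_comp_abs (f := fun x => x * rexp (-x ^ 2 / (2 * v))),
          half_line]
    _ = √(2 * v / π) := by
        symm
        rw [sqrt_eq_iff_mul_self_eq (by positivity) (by positivity)]
        rw [mul_mul_mul_comm, ← mul_inv, mul_self_sqrt (by positivity)]
        field_simp

/-- A linear combination of i.i.d. centered Gaussians is a centered Gaussian. -/
theorem map_sum_mul_pi_gaussianReal_zero {ι : Type*} [Fintype ι] (a : ι → ℝ) (v : NNReal) :
    (Measure.pi fun _ : ι => gaussianReal 0 v).map (fun u => ∑ i, a i * u i) =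
      gaussianReal 0 ((∑ i, a i ^ 2) * v).toNNReal := by
  have eq_sum : (fun u : ι → ℝ => ∑ i, a i * u i) = ∑ i, fun u : ι → ℝ => a i * u i := by
    ext u
    simp
  have law : HasGaussianLaw (∑ i, fun u : ι → ℝ => a i * u i)
      (Measure.pi fun _ : ι => gaussianReal 0 v) := by
    refine iIndepFun.hasGaussianLaw_sum (fun i => ?_)
      (iIndepFun_pi (μ := fun _ : ι => gaussianReal 0 v) (X := fun i x => a i * x)
        fun i => by fun_prop)
    have eval_law : HasLaw (fun u : ι → ℝ => u i) (gaussianReal 0 v)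
        (Measure.pi fun _ : ι => gaussianReal 0 v) :=
      ⟨(measurable_pi_apply i).aemeasurable, (measurePreserving_eval (fun _ : ι => gaussianReal 0 v) i).map_eq⟩
    exact (gaussianReal_const_mul eval_law (a i)).hasGaussianLaw
  rw [eq_sum, law.map_eq_gaussianReal]
  congr 2
  · rw [← eq_sum, integral_finsetSum]
    · simp [integral_const_mul, integral_eval]
    · exact fun i _ => (integrable_eval IsGaussian.integrable_id).const_mul _
  · rw [variance_sum_pi (X := fun i x => a i * x)
      fun i => IsGaussian.memLp_two_id.const_mul _]
    simp_rw [variance_const_mul (X := fun x => x), variance_fun_id_gaussianReal, Finset.sum_mul]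

/-- The geometric sum `∑_{i < h} r^{i+1-h}`, cleared of denominators. -/
theorem sum_zpow_add_one_sub (r : ℝ) (hr : r ≠ 0) (h : ℕ) :
    (r - 1) * ∑ i : Fin h, r ^ (((i : ℕ) : ℤ) + 1 - (h : ℤ)) = r * (1 - r ^ (-(h : ℤ))) := by
  have factor : ∀ i : ℕ, r ^ ((i : ℤ) + 1 - (h : ℤ)) = r ^ (-(h : ℤ)) * r * r ^ i := fun i => by
    rw [show (i : ℤ) + 1 - (h : ℤ) = -(h : ℤ) + 1 + i by ring, zpow_add₀ hr, zpow_add₀ hr]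
    simp
  rw [Fin.sum_univ_eq_sum_range (fun i : ℕ => r ^ ((i : ℤ) + 1 - (h : ℤ)))]
  simp_rw [factor]
  rw [← Finset.mul_sum]
  have geom := geom_sum_mul r h
  have cancel : r ^ (-(h : ℤ)) * r ^ h = 1 := by
    rw [zpow_neg, zpow_natCast, inv_mul_cancel₀ (pow_ne_zero _ hr)]
  linear_combination r ^ (-(h : ℤ)) * r * geom + r * cancel

/-- Expected total displacement bound: after `h` rounds of i.i.d. `N(0,σ₀²)` errors and
syndrome extraction without intermediate corrections, the expected absolute total shift
satisfies `E|θ_h| ≤ 2√π(1 − 2^{−h}) + σ₀ √(2(1 − 4^{−h})/(3π))`. The `k`-th round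
(`k = 1, …, h`) is indexed by `i : Fin h` with `k = i + 1`. -/
theorem expected_drift_bound (h : ℕ) (hh : 1 ≤ h) (σ₀ : ℝ) (hσ : 0 < σ₀)
    (f : ℝ → ℝ) (hf : ∀ y : ℝ, |f y| ≤ Real.sqrt Real.pi)
    (x : ℕ → ℝ) (X : ℕ → ℝ)
    (hX1 : X 1 = x 1)
    (hX : ∀ k : ℕ, 2 ≤ k → X k = x k + (1 / Real.sqrt 2) *
      ∑ j ∈ Finset.Icc 1 (k - 1), (2 : ℝ) ^ ((j : ℤ) + 1 - (k : ℤ)) * f (X j)) :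
    (∫ u : Fin h → ℝ,
        |∑ i : Fin h, (2 : ℝ) ^ (((i : ℕ) : ℤ) + 1 - (h : ℤ)) *
          (u i / 2 - f (X ((i : ℕ) + 1)))|
      ∂(Measure.pi fun _ : Fin h => gaussianReal 0 (σ₀ ^ 2).toNNReal)) ≤
    2 * Real.sqrt Real.pi * (1 - (2 : ℝ) ^ (-(h : ℤ))) +
      σ₀ * Real.sqrt (2 * (1 - (4 : ℝ) ^ (-(h : ℤ))) / (3 * Real.pi)) := by
  set μ := Measure.pi fun _ : Fin h => gaussianReal 0 (σ₀ ^ 2).toNNReal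
  set c : Fin h → ℝ := fun i => (2 : ℝ) ^ (((i : ℕ) : ℤ) + 1 - (h : ℤ))
  have c_nonneg : ∀ i, 0 ≤ c i := fun i => by positivity
  have sum_c : ∑ i, c i = 2 * (1 - (2 : ℝ) ^ (-(h : ℤ))) := by
    linear_combination sum_zpow_add_one_sub 2 two_ne_zero h
  have sum_c_sq : ∑ i, (c i / 2) ^ 2 = (1 - (4 : ℝ) ^ (-(h : ℤ))) / 3 := by
    have c_sq : ∀ i, (c i / 2) ^ 2 = (4 : ℝ) ^ (((i : ℕ) : ℤ) + 1 - (h : ℤ)) / 4 := fun i => by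
      rw [div_pow, sq (c i), ← mul_zpow]
      norm_num
    simp_rw [c_sq]
    rw [← Finset.sum_div]
    linear_combination (1 / 12) * sum_zpow_add_one_sub 4 four_ne_zero h
  have integrable_noise : Integrable (fun u : Fin h → ℝ => |∑ i, c i / 2 * u i|) μ :=
    (integrable_finsetSum _ fun i _ =>
      (integrable_eval IsGaussian.integrable_id).const_mul _).abs
  have pointwise : ∀ u : Fin h → ℝ, |∑ i, c i * (u i / 2 - f (X ((i : ℕ) + 1)))| ≤
      |∑ i, c i / 2 * u i| + √π * ∑ i, c i := fun u => by
    have split : ∑ i, c i * (u i / 2 - f (X ((i : ℕ) + 1))) =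
        ∑ i, c i / 2 * u i - ∑ i, c i * f (X ((i : ℕ) + 1)) := by
      rw [← Finset.sum_sub_distrib]
      exact Finset.sum_congr rfl fun i _ => by ring
    rw [split]
    refine (abs_sub _ _).trans (add_le_add_right ?_ _)
    rw [Finset.mul_sum]
    refine (Finset.abs_sum_le_sum_abs _ _).trans (Finset.sum_le_sum fun i _ => ?_)
    rw [abs_mul, abs_of_nonneg (c_nonneg i), mul_comm]
    exact mul_le_mul_of_nonneg_right (hf _) (c_nonneg i)
  have mean_noise : ∫ u : Fin h → ℝ, |∑ i, c i / 2 * u i| ∂μ =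
      σ₀ * √(2 * (1 - (4 : ℝ) ^ (-(h : ℤ))) / (3 * π)) := by
    rw [← integral_map (φ := fun u : Fin h → ℝ => ∑ i, c i / 2 * u i) (f := fun x : ℝ => |x|)
      (Measurable.aemeasurable (by fun_prop)) (by fun_prop),
      map_sum_mul_pi_gaussianReal_zero, integral_abs_gaussianReal_zero,
      coe_toNNReal _ (by positivity), coe_toNNReal _ (by positivity), sum_c_sq]
    nth_rw 2 [← sqrt_sq hσ.le]
    rw [← sqrt_mul (sq_nonneg σ₀)]
    congr 1
    field_simp
  calc ∫ u : Fin h → ℝ, |∑ i, c i * (u i / 2 - f (X ((i : ℕ) + 1)))| ∂μ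
      ≤ ∫ u : Fin h → ℝ, (|∑ i, c i / 2 * u i| + √π * ∑ i, c i) ∂μ :=
        integral_mono_of_nonneg (.of_forall fun u => abs_nonneg _)
          (integrable_noise.add (integrable_const _)) (.of_forall pointwise)
    _ = _ := by
        rw [integral_add integrable_noise (integrable_const _), mean_noise, sum_c]
        simp only [integral_const, probReal_univ, smul_eq_mul]
        ring
end

section
/- Fix an integer M ≥ 1 and let B be the M×M real matrix with entries B_{αβ} = 2^{α+β} · Σ_{h=max(α,β)}^{M} 4^{−h} (indices 1 ≤ α, β ≤ M). Then every entry satisfies 0 < B_{αβ} ≤ (4/3) · 2^{−|α−β|}, and every row sum satisfies Σ_{β=1}^{M} B_{αβ} < 4 for all 1 ≤ α ≤ M. -/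
open Real Finset

theorem sum_Icc_four_zpow_neg {m n : ℕ} (h : m ≤ n) :
    ∑ i ∈ Finset.Icc m n, (4 : ℝ) ^ (-(i : ℤ)) =
      4 / 3 * (4 : ℝ) ^ (-(m : ℤ)) - 1 / 3 * (4 : ℝ) ^ (-(n : ℤ)) := by
  induction n, h using Nat.le_induction with
  | base => simp; ring
  | succ n hmn ih =>
    rw [Finset.sum_Icc_succ_top (by omega), ih]
    have h4 : (4 : ℝ) ^ (-(n : ℤ)) = 4 * (4 : ℝ) ^ (-((n + 1 : ℕ) : ℤ)) := by
      rw [← zpow_one_add₀ (by norm_num)]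
      congr 1
      push_cast
      ring
    rw [h4]
    ring

theorem sum_Icc_two_zpow_sub (a : ℤ) (n : ℕ) :
    ∑ i ∈ Finset.Icc 1 n, (2 : ℝ) ^ ((i : ℤ) - a) =
      2 * (2 : ℝ) ^ ((n : ℤ) - a) - 2 * (2 : ℝ) ^ (-a) := by
  induction n with
  | zero => simp
  | succ n ih =>
    rw [Finset.sum_Icc_succ_top (by omega), ih]
    have h2 : (2 : ℝ) ^ (((n + 1 : ℕ) : ℤ) - a) = 2 * (2 : ℝ) ^ ((n : ℤ) - a) := by
      rw [← zpow_one_add₀ (by norm_num)]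
      congr 1
      push_cast
      ring
    rw [h2]
    ring

theorem sum_Icc_two_zpow_neg_abs {a n : ℕ} (h : a ≤ n) :
    ∑ i ∈ Finset.Icc 1 n, (2 : ℝ) ^ (-|(a : ℤ) - (i : ℤ)|) =
      3 - 2 * (2 : ℝ) ^ (-(a : ℤ)) - (2 : ℝ) ^ ((a : ℤ) - (n : ℤ)) := by
  induction n, h using Nat.le_induction with
  | base =>
    have hsum : ∑ i ∈ Finset.Icc 1 a, (2 : ℝ) ^ (-|(a : ℤ) - (i : ℤ)|) =
        ∑ i ∈ Finset.Icc 1 a, (2 : ℝ) ^ ((i : ℤ) - (a : ℤ)) := by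
      refine Finset.sum_congr rfl fun i hi => ?_
      rw [Finset.mem_Icc] at hi
      rw [abs_of_nonneg (by omega), neg_sub]
    rw [hsum, sum_Icc_two_zpow_sub, sub_self, zpow_zero]
    ring
  | succ n han ih =>
    rw [Finset.sum_Icc_succ_top (by omega), ih, abs_of_nonpos (by omega), neg_neg]
    have h2 : (2 : ℝ) ^ ((a : ℤ) - (n : ℤ)) = 2 * (2 : ℝ) ^ ((a : ℤ) - ((n + 1 : ℕ) : ℤ)) := by
      rw [← zpow_one_add₀ (by norm_num)]
      congr 1
      push_cast
      ring
    rw [h2]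
    ring

theorem two_pow_add_mul_four_zpow_neg_max (a b : ℕ) :
    (2 : ℝ) ^ (a + b) * (4 : ℝ) ^ (-((max a b : ℕ) : ℤ)) =
      (2 : ℝ) ^ (-|(a : ℤ) - (b : ℤ)|) := by
  rw [show (4 : ℝ) = (2 : ℝ) ^ (2 : ℤ) by norm_num, ← zpow_mul, ← zpow_natCast,
    ← zpow_add₀ (by norm_num)]
  congr 1
  rcases le_total a b with h | h
  · rw [max_eq_right h, abs_of_nonpos (by omega)]
    push_cast
    ring
  · rw [max_eq_left h, abs_of_nonneg (by omega)]
    push_cast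
    ring

/-- Entrywise and row-sum bounds for the off-identity part
`B_{αβ} = 2^{α+β}·Σ_{h=max(α,β)}^{M} 4^{−h}` of the precision matrix:
`0 < B_{αβ} ≤ (4/3)·2^{−|α−β|}` and every row sum is `< 4`. -/
theorem B_matrix_bounds (M : ℕ) (hM : 1 ≤ M)
    (B : ℕ → ℕ → ℝ)
    (hB : ∀ α β, B α β =
      2 ^ (α + β) * ∑ h ∈ Finset.Icc (max α β) M, (4 : ℝ) ^ (-(h : ℤ))) :
    (∀ α ∈ Finset.Icc 1 M, ∀ β ∈ Finset.Icc 1 M,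
        0 < B α β ∧ B α β ≤ (4 / 3) * (2 : ℝ) ^ (-|(α : ℤ) - (β : ℤ)|)) ∧
    ∀ α ∈ Finset.Icc 1 M, (∑ β ∈ Finset.Icc 1 M, B α β) < 4 := by
  have entry : ∀ α ∈ Finset.Icc 1 M, ∀ β ∈ Finset.Icc 1 M,
      0 < B α β ∧ B α β ≤ (4 / 3) * (2 : ℝ) ^ (-|(α : ℤ) - (β : ℤ)|) := by
    intro α hα β hβ
    rw [Finset.mem_Icc] at hα hβ
    have hmax : max α β ≤ M := max_le hα.2 hβ.2
    rw [hB]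
    constructor
    · exact mul_pos (by positivity)
        (Finset.sum_pos (fun _ _ => by positivity) (Finset.nonempty_Icc.mpr hmax))
    · rw [← two_pow_add_mul_four_zpow_neg_max, sum_Icc_four_zpow_neg hmax, mul_left_comm]
      have hM4 : (0 : ℝ) < (4 : ℝ) ^ (-(M : ℤ)) := by positivity
      gcongr
      linarith
  refine ⟨entry, fun α hα => ?_⟩
  have hle := Finset.sum_le_sum fun β hβ => (entry α hα β hβ).2
  rw [Finset.mem_Icc] at hα
  rw [← Finset.mul_sum, sum_Icc_two_zpow_neg_abs hα.2] at hle
  have h1 : (0 : ℝ) < (2 : ℝ) ^ (-(α : ℤ)) := by positivity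
  have h2 : (0 : ℝ) < (2 : ℝ) ^ ((α : ℤ) - (M : ℤ)) := by positivity
  linarith
end

section
/- Fix an integer M ≥ 1, let B be the M×M matrix with entries B_{αβ} = 2^{α+β} · Σ_{h=max(α,β)}^{M} 4^{−h}, and let a ∈ ℝ^M have entries a_k = 2^{k−M−1}. Then Σ_{α=1}^{M} Σ_{β=1}^{M} a_α a_β B_{αβ} = (4/27) · (4 − 3(1+2M)·4^{−M} − 4^{−2M}). -/
open Real Finset

/-- Exchanging the order of summation in a quadratic form whose kernel is a tail sum
starting at `max α β`. -/
theorem sum_mul_sum_Icc_max {R : Type*} [CommSemiring R] (f g : ℕ → R) (M : ℕ) :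
    (∑ α ∈ Finset.Icc 1 M, ∑ β ∈ Finset.Icc 1 M,
      f α * f β * ∑ h ∈ Finset.Icc (max α β) M, g h) =
      ∑ h ∈ Finset.Icc 1 M, g h * (∑ α ∈ Finset.Icc 1 h, f α) ^ 2 := by
  have inner : ∀ α ∈ Finset.Icc 1 M,
      (∑ β ∈ Finset.Icc 1 M, f α * f β * ∑ h ∈ Finset.Icc (max α β) M, g h) =
        ∑ h ∈ Finset.Icc α M, ∑ β ∈ Finset.Icc 1 h, f α * f β * g h := by
    intro α _
    simp_rw [Finset.mul_sum]
    apply Finset.sum_comm'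
    intro β h
    simp only [Finset.mem_Icc]
    omega
  rw [Finset.sum_congr rfl inner]
  rw [Finset.sum_comm' (t' := Finset.Icc 1 M) (s' := fun h => Finset.Icc 1 h)
    (by intro α h; simp only [Finset.mem_Icc]; omega)]
  refine Finset.sum_congr rfl fun h _ => ?_
  rw [sq, Finset.sum_mul_sum, Finset.mul_sum]
  refine Finset.sum_congr rfl fun α _ => ?_
  rw [Finset.mul_sum]
  exact Finset.sum_congr rfl fun β _ => by ring

theorem sum_Icc_one_four_pow (n : ℕ) :
    ∑ k ∈ Finset.Icc 1 n, (4 : ℝ) ^ k = 4 * (4 ^ n - 1) / 3 := by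
  induction n with
  | zero => simp
  | succ n ih => rw [Finset.sum_Icc_succ_top (by omega), ih]; ring

theorem sum_Icc_one_inv_four_pow_mul_sq (n : ℕ) :
    ∑ h ∈ Finset.Icc 1 n, ((4 : ℝ) ^ h)⁻¹ * (4 * (4 ^ h - 1) / 3) ^ 2 =
      16 / 27 * (4 * 4 ^ n - 3 - 6 * n - ((4 : ℝ) ^ n)⁻¹) := by
  induction n with
  | zero => norm_num
  | succ n ih =>
    rw [Finset.sum_Icc_succ_top (by omega), ih]
    push_cast
    field_simp
    ring

/-- Closed form of the quadratic form `a^T B a`, where `a_k = 2^{k−M−1}` weights the round-`k`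
error in the total displacement and `B_{αβ} = 2^{α+β}·Σ_{h=max(α,β)}^{M} 4^{−h}`:
`a^T B a = (4/27)·(4 − 3(1+2M)·4^{−M} − 4^{−2M})`. -/
theorem aBa_closed_form (M : ℕ) (hM : 1 ≤ M)
    (B : ℕ → ℕ → ℝ)
    (hB : ∀ α β, B α β =
      2 ^ (α + β) * ∑ h ∈ Finset.Icc (max α β) M, (4 : ℝ) ^ (-(h : ℤ)))
    (a : ℕ → ℝ) (ha : ∀ k, a k = (2 : ℝ) ^ ((k : ℤ) - (M : ℤ) - 1)) :
    (∑ α ∈ Finset.Icc 1 M, ∑ β ∈ Finset.Icc 1 M, a α * a β * B α β) =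
      (4 / 27) * (4 - 3 * (1 + 2 * (M : ℝ)) * (4 : ℝ) ^ (-(M : ℤ)) -
        (4 : ℝ) ^ (-2 * (M : ℤ))) := by
  have term : ∀ α β, a α * a β * B α β =
      (4 * (4 : ℝ) ^ M)⁻¹ *
        ((4 : ℝ) ^ α * 4 ^ β * ∑ h ∈ Finset.Icc (max α β) M, ((4 : ℝ) ^ h)⁻¹) := by
    intro α β
    have h2 : (2 : ℝ) ≠ 0 := two_ne_zero
    have four_pow : ∀ n : ℕ, (4 : ℝ) ^ n = 2 ^ n * 2 ^ n := fun n => by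
      rw [← mul_pow]; norm_num
    simp only [ha, hB, zpow_sub₀ h2, zpow_natCast, zpow_neg, zpow_one, pow_add]
    rw [four_pow α, four_pow β, four_pow M]
    field_simp
    ring
  simp_rw [term, ← Finset.mul_sum]
  rw [sum_mul_sum_Icc_max]
  simp_rw [sum_Icc_one_four_pow]
  rw [sum_Icc_one_inv_four_pow_mul_sq]
  rw [show (-2 * (M : ℤ)) = -(M : ℤ) + -(M : ℤ) by ring, zpow_add₀ (by norm_num)]
  simp only [zpow_neg, zpow_natCast]
  field_simp
  ring
end
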